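/- Let m, d be positive integers and τ > 0. If ω_1, …, ω_d are independent random vectors in ℝ^m, each distributed according to the standard Gaussian measure on ℝ^m (density (2π)^{−m/2} exp(−‖ω‖²/2)), then for all x, y ∈ ℝ^m the random-feature inner product is an unbiased estimator of the Gaussian kernel: E[φ(x)ᵀφ(y)] = exp(−‖x−y‖²/(2τ²)), where φ(x) = (1/√d)·(cos(ω_1ᵀx/τ), …, cos(ω_dᵀx/τ), sin(ω_1ᵀx/τ), …, sin(ω_dᵀx/τ)). -/

import Mathlib

open MeasureTheory Real Finset
open scoped RealInnerProductSpace ENNReal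

/-- The standard Gaussian measure on `ℝ^m`, with density
`(2π)^{-m/2} exp(-‖ω‖²/2)` with respect to Lebesgue measure. -/
noncomputable def stdGaussian (m : ℕ) : Measure (EuclideanSpace ℝ (Fin m)) :=
  volume.withDensity
    (fun ω => ENNReal.ofReal ((2 * π) ^ (-(m : ℝ) / 2) * Real.exp (-‖ω‖ ^ 2 / 2)))

lemma rf_cos_vol (m : ℕ) (w : EuclideanSpace ℝ (Fin m)) :
    Integrable (fun v : EuclideanSpace ℝ (Fin m) =>
      Real.exp (-‖v‖ ^ 2 / 2) * Real.cos ⟪w, v⟫) ∧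
    ∫ v : EuclideanSpace ℝ (Fin m), Real.exp (-‖v‖ ^ 2 / 2) * Real.cos ⟪w, v⟫ =
      (2 * π) ^ ((m : ℝ) / 2) * Real.exp (-‖w‖ ^ 2 / 2) := by
  have hb : 0 < ((1 / 2 : ℝ) : ℂ).re := by simp
  have hI := GaussianFourier.integrable_cexp_neg_mul_sq_norm_add hb Complex.I w
  have h := GaussianFourier.integral_cexp_neg_mul_sq_norm_add hb Complex.I w
  have hre : ∀ v : EuclideanSpace ℝ (Fin m),
      (Complex.exp (-((1 / 2 : ℝ) : ℂ) * (‖v‖ : ℂ) ^ 2 + Complex.I * ((⟪w, v⟫ : ℝ) : ℂ))).re =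
      Real.exp (-‖v‖ ^ 2 / 2) * Real.cos ⟪w, v⟫ := by
    intro v
    have : -((1 / 2 : ℝ) : ℂ) * (‖v‖ : ℂ) ^ 2 + Complex.I * ((⟪w, v⟫ : ℝ) : ℂ)
      = ((-‖v‖ ^ 2 / 2 : ℝ) : ℂ) + ((⟪w, v⟫ : ℝ) : ℂ) * Complex.I := by
      push_cast; ring
    rw [this, Complex.exp_re]
    simp only [Complex.add_re, Complex.add_im, Complex.ofReal_re, Complex.ofReal_im,
      Complex.re_ofReal_mul, Complex.im_ofReal_mul, Complex.I_re, Complex.I_im, mul_zero, mul_one,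
      add_zero, zero_add]
  have hrhs : ((π : ℂ) / ((1 / 2 : ℝ) : ℂ)) ^
        ((Module.finrank ℝ (EuclideanSpace ℝ (Fin m)) : ℂ) / 2) *
        Complex.exp (Complex.I ^ 2 * (‖w‖ : ℂ) ^ 2 / (4 * ((1 / 2 : ℝ) : ℂ))) =
      (((2 * π) ^ ((m : ℝ) / 2) * Real.exp (-‖w‖ ^ 2 / 2) : ℝ) : ℂ) := by
    rw [finrank_euclideanSpace_fin, Complex.ofReal_mul, Complex.ofReal_cpow (by positivity),
      Complex.ofReal_exp, Complex.I_sq]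
    congr 2
    · push_cast; ring
    · push_cast; ring
    · push_cast; ring
  rw [hrhs] at h
  refine ⟨hI.re.congr (Filter.Eventually.of_forall hre), ?_⟩
  have h2 := integral_re hI
  rw [h] at h2
  refine Eq.trans (integral_congr_ae (Filter.Eventually.of_forall fun v => (hre v).symm)) ?_
  exact h2.trans (Complex.ofReal_re _)

lemma rf_const (m : ℕ) : (2 * π) ^ (-(m : ℝ) / 2) * (2 * π) ^ ((m : ℝ) / 2) = 1 := by
  rw [← Real.rpow_add (by positivity)]
  ring_nf
  simp

lemma rf_prob (m : ℕ) : IsProbabilityMeasure (stdGaussian m) := by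
  constructor
  obtain ⟨h1, h2⟩ := rf_cos_vol m 0
  simp only [inner_zero_left, Real.cos_zero, mul_one, norm_zero] at h1 h2
  rw [stdGaussian, withDensity_apply _ MeasurableSet.univ, Measure.restrict_univ,
    ← ofReal_integral_eq_lintegral_ofReal (h1.const_mul _)
      (Filter.Eventually.of_forall fun v => by positivity), integral_const_mul, h2, ← mul_assoc,
    rf_const]
  simp

lemma rf_cos (m : ℕ) (w : EuclideanSpace ℝ (Fin m)) :
    ∫ v, Real.cos ⟪w, v⟫ ∂(stdGaussian m) = Real.exp (-‖w‖ ^ 2 / 2) := by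
  rw [stdGaussian, integral_withDensity_eq_integral_toReal_smul (by fun_prop)
    (Filter.Eventually.of_forall fun v => ENNReal.ofReal_lt_top)]
  have : ∀ v : EuclideanSpace ℝ (Fin m),
    (ENNReal.ofReal ((2 * π) ^ (-(m : ℝ) / 2) * Real.exp (-‖v‖ ^ 2 / 2))).toReal •
      Real.cos ⟪w, v⟫ =
    (2 * π) ^ (-(m : ℝ) / 2) * (Real.exp (-‖v‖ ^ 2 / 2) * Real.cos ⟪w, v⟫) := by
    intro v
    rw [ENNReal.toReal_ofReal (by positivity), smul_eq_mul, mul_assoc]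
  simp_rw [this]
  rw [integral_const_mul, (rf_cos_vol m w).2, ← mul_assoc, rf_const, one_mul]

lemma rf_sum (d : ℕ) (f : Fin (2 * d) → ℝ) : ∑ i, f i =
    ∑ j : Fin d, (f ⟨j, by omega⟩ + f ⟨d + j, by omega⟩) := by
  rw [← Equiv.sum_comp (finCongr (two_mul d).symm) f, Fin.sum_univ_add, ← Finset.sum_add_distrib]
  rfl

theorem random_features_unbiased (m d : ℕ) (hm : 0 < m) (hd : 0 < d)
    (τ : ℝ) (hτ : 0 < τ)
    (φ : (Fin d → EuclideanSpace ℝ (Fin m)) → EuclideanSpace ℝ (Fin m) →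
      EuclideanSpace ℝ (Fin (2 * d)))
    (hφ : ∀ ω x, ∀ i : Fin (2 * d), φ ω x i =
      if h : (i : ℕ) < d then (1 / Real.sqrt d) * Real.cos (⟪ω ⟨i, h⟩, x⟫ / τ)
      else (1 / Real.sqrt d) *
        Real.sin (⟪ω ⟨(i : ℕ) - d, by have := i.isLt; omega⟩, x⟫ / τ))
    (x y : EuclideanSpace ℝ (Fin m)) :
    ∫ ω : Fin d → EuclideanSpace ℝ (Fin m), ⟪φ ω x, φ ω y⟫
        ∂(Measure.pi fun _ : Fin d => stdGaussian m)
      = Real.exp (-‖x - y‖ ^ 2 / (2 * τ ^ 2)) := by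
  have := rf_prob m
  have hd' : (0 : ℝ) < d := by exact_mod_cast hd
  have key : ∀ ω : Fin d → EuclideanSpace ℝ (Fin m), ⟪φ ω x, φ ω y⟫ =
      ∑ j : Fin d, (1 / (d : ℝ)) * Real.cos ⟪(1 / τ) • (x - y), ω j⟫ := by
    intro ω
    rw [PiLp.inner_apply, rf_sum]
    refine Finset.sum_congr rfl fun j _ => ?_
    have hs : (1 / Real.sqrt d) * (1 / Real.sqrt d) = 1 / (d : ℝ) := by
      rw [div_mul_div_comm, Real.mul_self_sqrt hd'.le, one_mul]
    have hc : ⟪(1 / τ) • (x - y), ω j⟫ = ⟪ω j, x⟫ / τ - ⟪ω j, y⟫ / τ := by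
      rw [real_inner_smul_left, inner_sub_left, real_inner_comm, real_inner_comm _ y]
      ring
    have hlt : ¬ (d + (j : ℕ) < d) := by omega
    simp only [hφ, j.isLt, hlt, dif_pos, dif_neg, not_false_eq_true, Nat.add_sub_cancel_left,
      Fin.eta, RCLike.inner_apply, conj_trivial]
    rw [hc, Real.cos_sub, ← hs]
    ring
  simp_rw [key]
  have hcont : Continuous fun v : EuclideanSpace ℝ (Fin m) =>
      Real.cos ⟪(1 / τ) • (x - y), v⟫ := by fun_prop
  rw [integral_finsetSum]
  · have hone : ∀ j : Fin d, ∫ ω : Fin d → EuclideanSpace ℝ (Fin m),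
        (1 / (d : ℝ)) * Real.cos ⟪(1 / τ) • (x - y), ω j⟫
        ∂(Measure.pi fun _ : Fin d => stdGaussian m) =
        (1 / (d : ℝ)) * Real.exp (-‖x - y‖ ^ 2 / (2 * τ ^ 2)) := by
      intro j
      rw [integral_const_mul]
      congr 1
      have hmp := measurePreserving_eval (fun _ : Fin d => stdGaussian m) j
      have h3 := integral_map (μ := Measure.pi fun _ : Fin d => stdGaussian m)
        hmp.measurable.aemeasurable (f := fun v => Real.cos ⟪(1 / τ) • (x - y), v⟫)
        hcont.aestronglyMeasurable
      rw [hmp.map_eq, rf_cos] at h3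
      refine h3.symm.trans ?_
      rw [norm_smul, mul_pow, Real.norm_eq_abs, sq_abs]
      congr 1
      field_simp
    simp_rw [hone]
    rw [Finset.sum_const, Finset.card_univ, Fintype.card_fin, nsmul_eq_mul]
    field_simp
  · intro j _
    refine Integrable.const_mul ?_ _
    refine Integrable.of_bound (C := 1) ?_ (Filter.Eventually.of_forall fun ω => ?_)
    · exact (hcont.comp (continuous_apply j)).aestronglyMeasurable
    · rw [Real.norm_eq_abs]; exact Real.abs_cos_le_one _
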